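/- Let (E,j) be a soft inductive system of Banach spaces over a directed set N and let A_• be a net of closed linear operators A_n : D(A_n) ⊆ E_n → E_n. Let dom(A_•) be the set of j-convergent nets x_• with x_n ∈ D(A_n) for all n and with (A_n x_n)_n j-convergent. Then the set Γ_∞ = { (j-lim_n x_n, j-lim_n A_n x_n) : x_• ∈ dom(A_•) } is a closed subspace of E_∞ ⊕ E_∞. -/

import Mathlib

open Filter Topology MeasureTheory

variable {N : Type*} [Preorder N] [IsDirected N (· ≤ ·)] [Nonempty N]
variable {E : N → Type*} [∀ n, NormedAddCommGroup (E n)] [∀ n, NormedSpace ℂ (E n)]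
  [∀ n, CompleteSpace (E n)]

/-- A *soft inductive system* of Banach spaces over the directed set `N`:
linear contractions `j n m : E m → E n` (for `n ≥ m`, with `j n n = id` and
`j n m = 0` when `¬ m ≤ n`), satisfying
`lim_m limsup_n ‖(j n l - j n m ∘ j m l) x‖ = 0` for all `l` and `x : E l`. -/
structure IsSoftInductiveSystem (j : ∀ n m : N, E m →L[ℂ] E n) : Prop where
  map_self : ∀ n, j n n = ContinuousLinearMap.id ℂ (E n)
  map_not_le : ∀ n m, ¬ m ≤ n → j n m = 0
  contraction : ∀ n m, m ≤ n → ∀ x : E m, ‖j n m x‖ ≤ ‖x‖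
  soft : ∀ (l : N) (x : E l),
    Tendsto (fun m => limsup (fun n => ‖j n l x - j n m (j m l x)‖) atTop)
      atTop (𝓝 0)

/-- A net `x = (x n)_{n ∈ N}` (with `x n ∈ E n`) is uniformly bounded. -/
def UniformlyBounded (x : ∀ n, E n) : Prop := ∃ C : ℝ, ∀ n, ‖x n‖ ≤ C

/-- The seminorm `|‖x‖| = limsup_n ‖x n‖` on uniformly bounded nets. -/
noncomputable def netSeminorm (x : ∀ n, E n) : ℝ := limsup (fun n => ‖x n‖) atTop

/-- The basic net `j_{• m} ξ` associated with `ξ ∈ E m`. -/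
def basicNet (j : ∀ n m : N, E m →L[ℂ] E n) (m : N) (ξ : E m) : ∀ n, E n :=
  fun n => j n m ξ

/-- A uniformly bounded net is `j`-convergent if it lies in the seminorm-closure of
the set of basic nets. -/
def JConvergent (j : ∀ n m : N, E m →L[ℂ] E n) (x : ∀ n, E n) : Prop :=
  UniformlyBounded x ∧
    ∀ ε : ℝ, 0 < ε → ∃ (m : N) (ξ : E m), netSeminorm (fun n => x n - j n m ξ) < ε

/-- A net is a null net if `lim_n ‖x n‖ = 0`. -/
def IsNullNet (x : ∀ n, E n) : Prop := Tendsto (fun n => ‖x n‖) atTop (𝓝 0)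

/-- A realization `(G, L)` of the limit space `E_∞ = C(E,j)/C₀(E,j)` of a soft inductive
system: `L` sends a `j`-convergent net to its `j`-limit; it is linear on `j`-convergent
nets, the norm of a `j`-limit is the seminorm of the net, and every element of `G`
arises as a `j`-limit. -/
structure IsLimitSpace (j : ∀ n m : N, E m →L[ℂ] E n) (G : Type*)
    [NormedAddCommGroup G] [NormedSpace ℂ G] (L : (∀ n, E n) → G) : Prop where
  map_add : ∀ x y, JConvergent j x → JConvergent j y → L (x + y) = L x + L y
  map_smul : ∀ (c : ℂ) (x), JConvergent j x → L (c • x) = c • L x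
  norm_eq : ∀ x, JConvergent j x → ‖L x‖ = netSeminorm x
  surjective : ∀ g : G, ∃ x, JConvergent j x ∧ L x = g

open scoped ENNReal

set_option linter.unusedSectionVars false

theorem isBoundedUnder_norm_of_uniformlyBounded {x : ∀ n, E n} (hx : UniformlyBounded x) :
    IsBoundedUnder (· ≤ ·) atTop (fun n => ‖x n‖) := by
  obtain ⟨C, hC⟩ := hx
  exact isBoundedUnder_of ⟨C, hC⟩

theorem UniformlyBounded.eventually_lt {x : ∀ n, E n} (hx : UniformlyBounded x) {ε : ℝ}
    (h : netSeminorm x < ε) : ∀ᶠ n in atTop, ‖x n‖ < ε :=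
  eventually_lt_of_limsup_lt h (isBoundedUnder_norm_of_uniformlyBounded hx)

theorem netSeminorm_le_of_eventually_le {x : ∀ n, E n} {ε : ℝ}
    (h : ∀ᶠ n in atTop, ‖x n‖ ≤ ε) : netSeminorm x ≤ ε :=
  limsup_le_of_le (isCoboundedUnder_le_of_le atTop fun n => norm_nonneg (x n)) h

theorem UniformlyBounded.sub {x y : ∀ n, E n} (hx : UniformlyBounded x)
    (hy : UniformlyBounded y) : UniformlyBounded (fun n => x n - y n) := by
  obtain ⟨C, hC⟩ := hx
  obtain ⟨D, hD⟩ := hy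
  exact ⟨C + D, fun n => (norm_sub_le _ _).trans (add_le_add (hC n) (hD n))⟩

theorem UniformlyBounded.memℓp {x : ∀ n, E n} (hx : UniformlyBounded x) : Memℓp x ∞ := by
  obtain ⟨C, hC⟩ := hx
  exact memℓp_infty ⟨C, by rintro _ ⟨n, rfl⟩; exact hC n⟩

theorem uniformlyBounded_coe (x : lp E ∞) : UniformlyBounded (x : ∀ n, E n) :=
  ⟨‖x‖, fun n => lp.norm_apply_le_norm ENNReal.top_ne_zero x n⟩

namespace IsSoftInductiveSystem

variable {j : ∀ n m : N, E m →L[ℂ] E n}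

theorem norm_map_le (hj : IsSoftInductiveSystem j) (n m : N) (ξ : E m) : ‖j n m ξ‖ ≤ ‖ξ‖ := by
  by_cases h : m ≤ n
  · exact hj.contraction n m h ξ
  · simp [hj.map_not_le n m h]

theorem uniformlyBounded_basic (hj : IsSoftInductiveSystem j) (m : N) (ξ : E m) :
    UniformlyBounded (fun n => j n m ξ) :=
  ⟨‖ξ‖, fun n => hj.norm_map_le n m ξ⟩

theorem eventually_soft (hj : IsSoftInductiveSystem j) (l : N) (ξ : E l) {ε : ℝ} (hε : 0 < ε) :
    ∀ᶠ m in atTop, ∀ᶠ n in atTop, ‖j n l ξ - j n m (j m l ξ)‖ < ε := by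
  filter_upwards [(hj.soft l ξ).eventually_lt_const hε] with m hm
  exact ((hj.uniformlyBounded_basic l ξ).sub
    (hj.uniformlyBounded_basic m (j m l ξ))).eventually_lt hm

theorem jConvergent_iff (hj : IsSoftInductiveSystem j) {x : ∀ n, E n} :
    JConvergent j x ↔ UniformlyBounded x ∧
      ∀ ε : ℝ, 0 < ε → ∃ (m : N) (ξ : E m), ∀ᶠ n in atTop, ‖x n - j n m ξ‖ < ε := by
  refine and_congr_right fun hx => ⟨fun h ε hε => ?_, fun h ε hε => ?_⟩
  · obtain ⟨m, ξ, hm⟩ := h ε hε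
    exact ⟨m, ξ, (hx.sub (hj.uniformlyBounded_basic m ξ)).eventually_lt hm⟩
  · obtain ⟨m, ξ, hm⟩ := h (ε / 2) (half_pos hε)
    exact ⟨m, ξ, (netSeminorm_le_of_eventually_le
      (hm.mono fun n hn => hn.le)).trans_lt (half_lt_self hε)⟩

theorem jConvergent_zero (hj : IsSoftInductiveSystem j) : JConvergent j (0 : ∀ n, E n) :=
  hj.jConvergent_iff.2 ⟨⟨0, by simp⟩, fun ε hε => ⟨Classical.arbitrary N, 0, by simp [hε]⟩⟩

theorem jConvergent_add (hj : IsSoftInductiveSystem j) {x y : ∀ n, E n}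
    (hx : JConvergent j x) (hy : JConvergent j y) : JConvergent j (x + y) := by
  rw [hj.jConvergent_iff] at hx hy ⊢
  obtain ⟨⟨C, hC⟩, hx⟩ := hx
  obtain ⟨⟨D, hD⟩, hy⟩ := hy
  refine ⟨⟨C + D, fun n => (norm_add_le _ _).trans (add_le_add (hC n) (hD n))⟩, fun ε hε => ?_⟩
  have hε' : 0 < ε / 4 := by positivity
  obtain ⟨l, ξ, hξ⟩ := hx _ hε'
  obtain ⟨k, η, hη⟩ := hy _ hε'
  obtain ⟨m, hmξ, hmη⟩ := ((hj.eventually_soft l ξ hε').and (hj.eventually_soft k η hε')).exists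
  refine ⟨m, j m l ξ + j m k η, ?_⟩
  filter_upwards [hξ, hη, hmξ, hmη] with n h₁ h₂ h₃ h₄
  have key : (x + y) n - j n m (j m l ξ + j m k η) =
      ((x n - j n l ξ) + (y n - j n k η)) +
        ((j n l ξ - j n m (j m l ξ)) + (j n k η - j n m (j m k η))) := by
    rw [map_add, Pi.add_apply]; abel
  rw [key]
  have := norm_add₄_le (a := x n - j n l ξ) (b := y n - j n k η)
    (c := j n l ξ - j n m (j m l ξ)) (d := j n k η - j n m (j m k η))
  rw [← add_assoc]
  linarith

theorem jConvergent_smul (hj : IsSoftInductiveSystem j) (c : ℂ) {x : ∀ n, E n}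
    (hx : JConvergent j x) : JConvergent j (c • x) := by
  rw [hj.jConvergent_iff] at hx ⊢
  obtain ⟨⟨C, hC⟩, hx⟩ := hx
  refine ⟨⟨‖c‖ * C, fun n => ?_⟩, fun ε hε => ?_⟩
  · rw [Pi.smul_apply, norm_smul]
    exact mul_le_mul_of_nonneg_left (hC n) (norm_nonneg c)
  · have hc : 0 < ‖c‖ + 1 := by positivity
    obtain ⟨m, ξ, hξ⟩ := hx (ε / (‖c‖ + 1)) (div_pos hε hc)
    refine ⟨m, c • ξ, hξ.mono fun n hn => ?_⟩
    rw [Pi.smul_apply, map_smul, ← smul_sub, norm_smul]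
    rw [lt_div_iff₀ hc] at hn
    nlinarith [norm_nonneg (x n - j n m ξ)]

theorem jConvergent_congr (hj : IsSoftInductiveSystem j) {x y : ∀ n, E n}
    (hx : JConvergent j x) (hy : UniformlyBounded y) (hxy : ∀ᶠ n in atTop, y n = x n) :
    JConvergent j y := by
  rw [hj.jConvergent_iff] at hx ⊢
  refine ⟨hy, fun ε hε => ?_⟩
  obtain ⟨m, ξ, hξ⟩ := hx.2 ε hε
  refine ⟨m, ξ, ?_⟩
  filter_upwards [hξ, hxy] with n h₁ h₂
  rwa [h₂]

/-- The `j`-convergent nets as a subspace of the Banach space of uniformly bounded nets. -/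
def convergentNets (hj : IsSoftInductiveSystem j) : Submodule ℂ (lp E ∞) where
  carrier := {x | JConvergent j (x : ∀ n, E n)}
  zero_mem' := hj.jConvergent_zero
  add_mem' := fun hx hy => hj.jConvergent_add hx hy
  smul_mem' := fun c _ hx => hj.jConvergent_smul c hx

theorem isClosed_convergentNets (hj : IsSoftInductiveSystem j) :
    IsClosed (hj.convergentNets : Set (lp E ∞)) := by
  refine isClosed_of_closure_subset fun x hx => hj.jConvergent_iff.2
    ⟨uniformlyBounded_coe x, fun ε hε => ?_⟩
  obtain ⟨y, hy, hxy⟩ := Metric.mem_closure_iff.1 hx (ε / 2) (half_pos hε)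
  obtain ⟨m, ξ, hξ⟩ := (hj.jConvergent_iff.1 hy).2 (ε / 2) (half_pos hε)
  refine ⟨m, ξ, hξ.mono fun n hn => ?_⟩
  rw [dist_eq_norm] at hxy
  have h₁ : ‖x n - y n‖ ≤ ‖x - y‖ := lp.norm_apply_le_norm ENNReal.top_ne_zero (x - y) n
  have h₂ := norm_sub_le_norm_sub_add_norm_sub (x n) (y n) (j n m ξ)
  linarith

instance (hj : IsSoftInductiveSystem j) : CompleteSpace hj.convergentNets :=
  hj.isClosed_convergentNets.completeSpace_coe

end IsSoftInductiveSystem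

namespace IsLimitSpace

variable {j : ∀ n m : N, E m →L[ℂ] E n}
  {G : Type*} [NormedAddCommGroup G] [NormedSpace ℂ G] {L : (∀ n, E n) → G}

theorem norm_limit_le (hL : IsLimitSpace j G L) (hj : IsSoftInductiveSystem j)
    (x : hj.convergentNets) : ‖L (x : lp E ∞)‖ ≤ ‖x‖ :=
  (hL.norm_eq _ x.2).trans_le (netSeminorm_le_of_eventually_le (.of_forall fun n =>
    lp.norm_apply_le_norm ENNReal.top_ne_zero (x : lp E ∞) n))

/-- The `j`-limit as a bounded operator on the space of `j`-convergent nets. -/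
noncomputable def limitCLM (hL : IsLimitSpace j G L) (hj : IsSoftInductiveSystem j) :
    hj.convergentNets →L[ℂ] G :=
  LinearMap.mkContinuous
    { toFun := fun x => L (x : lp E ∞)
      map_add' := fun x y => hL.map_add _ _ x.2 y.2
      map_smul' := fun c x => hL.map_smul c _ x.2 } 1 fun x => by
    rw [one_mul]
    exact hL.norm_limit_le hj x

theorem limitCLM_apply (hL : IsLimitSpace j G L) (hj : IsSoftInductiveSystem j)
    (x : hj.convergentNets) : hL.limitCLM hj x = L (x : lp E ∞) := rfl

theorem limitCLM_congr (hL : IsLimitSpace j G L) (hj : IsSoftInductiveSystem j)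
    {x y : hj.convergentNets}
    (hxy : ∀ᶠ n in atTop, (x : lp E ∞) n = (y : lp E ∞) n) :
    hL.limitCLM hj x = hL.limitCLM hj y := by
  rw [← sub_eq_zero, ← map_sub, ← norm_le_zero_iff, limitCLM_apply, hL.norm_eq _ (x - y).2]
  refine netSeminorm_le_of_eventually_le (hxy.mono fun n hn => ?_)
  simp [hn]

theorem eventually_norm_lt (hL : IsLimitSpace j G L) (hj : IsSoftInductiveSystem j)
    (x : hj.convergentNets) {r : ℝ} (hr : ‖hL.limitCLM hj x‖ < r) :
    ∀ᶠ n in atTop, ‖(x : lp E ∞) n‖ < r := by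
  rw [limitCLM_apply, hL.norm_eq _ x.2] at hr
  exact (uniformlyBounded_coe _).eventually_lt hr

end IsLimitSpace

namespace IsSoftInductiveSystem

variable {j : ∀ n m : N, E m →L[ℂ] E n}

/-- Pairs of `j`-convergent nets lying entrywise in the graphs of the operators `A n`. -/
def graphNets (hj : IsSoftInductiveSystem j) (A : ∀ n, E n →ₗ.[ℂ] E n) :
    Submodule ℂ (hj.convergentNets × hj.convergentNets) where
  carrier := {p | ∀ n, ((p.1 : lp E ∞) n, (p.2 : lp E ∞) n) ∈ (A n).graph}
  zero_mem' := fun n => (A n).graph.zero_mem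
  add_mem' := fun hp hq n => (A n).graph.add_mem (hp n) (hq n)
  smul_mem' := fun c _ hp n => (A n).graph.smul_mem c (hp n)

theorem isClosed_graphNets (hj : IsSoftInductiveSystem j) {A : ∀ n, E n →ₗ.[ℂ] E n}
    (hA : ∀ n, IsClosed ((A n).graph : Set (E n × E n))) :
    IsClosed (hj.graphNets A : Set (hj.convergentNets × hj.convergentNets)) := by
  have hev : ∀ n, Continuous fun x : hj.convergentNets => (x : lp E ∞) n := fun n =>
    (LipschitzWith.of_dist_le_mul (K := 1) fun x y => by
      rw [NNReal.coe_one, one_mul, dist_eq_norm, dist_eq_norm]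
      exact lp.norm_apply_le_norm ENNReal.top_ne_zero ((x - y : hj.convergentNets) : lp E ∞) n
      ).continuous
  have : (hj.graphNets A : Set (hj.convergentNets × hj.convergentNets)) =
      ⋂ n, (fun p : hj.convergentNets × hj.convergentNets =>
        ((p.1 : lp E ∞) n, (p.2 : lp E ∞) n)) ⁻¹' (A n).graph := by
    ext p; simp [graphNets]
  rw [this]
  exact isClosed_iInter fun n => (hA n).preimage
    (((hev n).comp continuous_fst).prodMk ((hev n).comp continuous_snd))

end IsSoftInductiveSystem

namespace IsLimitSpace

variable {j : ∀ n m : N, E m →L[ℂ] E n}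
  {G : Type*} [NormedAddCommGroup G] [NormedSpace ℂ G] {L : (∀ n, E n) → G}

/-- The pair of `j`-limits of a net in the graphs of the operators `A n`. -/
noncomputable def graphLimit (hL : IsLimitSpace j G L) (hj : IsSoftInductiveSystem j)
    (A : ∀ n, E n →ₗ.[ℂ] E n) : hj.graphNets A →L[ℂ] G × G :=
  ((hL.limitCLM hj).prodMap (hL.limitCLM hj)).comp (hj.graphNets A).subtypeL

/-- Setting the entries of large norm to zero does not change the pair of `j`-limits. -/
theorem exists_graphLimit_eq_norm_le (hL : IsLimitSpace j G L) (hj : IsSoftInductiveSystem j)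
    (A : ∀ n, E n →ₗ.[ℂ] E n) (p : hj.graphNets A) :
    ∃ q : hj.graphNets A, hL.graphLimit hj A q = hL.graphLimit hj A p ∧
      ‖q‖ ≤ 2 * ‖hL.graphLimit hj A p‖ := by
  classical
  rcases eq_or_ne (hL.graphLimit hj A p) 0 with h0 | h0
  · exact ⟨0, by simp [h0], by simp⟩
  set r := 2 * ‖hL.graphLimit hj A p‖ with hr
  have hpos : 0 < ‖hL.graphLimit hj A p‖ := norm_pos_iff.2 h0
  have hr0 : 0 ≤ r := by positivity
  obtain ⟨⟨x, y⟩, hp⟩ := p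
  have hx : ‖hL.limitCLM hj x‖ < r := (norm_fst_le (hL.graphLimit hj A ⟨(x, y), hp⟩)).trans_lt (by linarith)
  have hy : ‖hL.limitCLM hj y‖ < r := (norm_snd_le (hL.graphLimit hj A ⟨(x, y), hp⟩)).trans_lt (by linarith)
  let P : N → Prop := fun n => ‖(x : lp E ∞) n‖ ≤ r ∧ ‖(y : lp E ∞) n‖ ≤ r
  have hP : ∀ᶠ n in atTop, P n := by
    filter_upwards [hL.eventually_norm_lt hj x hx, hL.eventually_norm_lt hj y hy] with n h₁ h₂
    exact ⟨h₁.le, h₂.le⟩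
  have cut : ∀ z : hj.convergentNets, (∀ n, P n → ‖(z : lp E ∞) n‖ ≤ r) →
      ∃ w : hj.convergentNets, (∀ n, (w : lp E ∞) n = if P n then (z : lp E ∞) n else 0) ∧
        ‖w‖ ≤ r ∧ hL.limitCLM hj w = hL.limitCLM hj z := by
    intro z hz
    have hb : ∀ n, ‖(if P n then (z : lp E ∞) n else 0 : E n)‖ ≤ r := fun n => by
      split_ifs with h
      · exact hz n h
      · simpa using hr0
    have hev : ∀ᶠ n in atTop, (if P n then (z : lp E ∞) n else 0 : E n) = (z : lp E ∞) n :=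
      hP.mono fun n hn => if_pos hn
    let w : lp E ∞ := ⟨fun n => if P n then (z : lp E ∞) n else 0,
      UniformlyBounded.memℓp ⟨r, hb⟩⟩
    exact ⟨⟨w, hj.jConvergent_congr z.2 ⟨r, hb⟩ hev⟩, fun n => rfl,
      lp.norm_le_of_forall_le hr0 hb, hL.limitCLM_congr hj hev⟩
  obtain ⟨x', hx', hx'r, hLx'⟩ := cut x fun n hn => hn.1
  obtain ⟨y', hy', hy'r, hLy'⟩ := cut y fun n hn => hn.2
  refine ⟨⟨(x', y'), fun n => ?_⟩, Prod.ext hLx' hLy', max_le hx'r hy'r⟩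
  simp only [hx', hy']
  split_ifs
  · exact hp n
  · exact (A n).graph.zero_mem

theorem isClosed_range_graphLimit (hL : IsLimitSpace j G L) (hj : IsSoftInductiveSystem j)
    {A : ∀ n, E n →ₗ.[ℂ] E n} (hA : ∀ n, IsClosed ((A n).graph : Set (E n × E n))) :
    IsClosed ((hL.graphLimit hj A).range : Set (G × G)) := by
  have : CompleteSpace (hj.graphNets A) := (hj.isClosed_graphNets hA).completeSpace_coe
  let f : NormedAddGroupHom (hj.graphNets A) (G × G) :=
    (hL.graphLimit hj A).toLinearMap.toAddMonoidHom.mkNormedAddGroupHom 1 fun p => by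
      rw [one_mul]
      exact max_le_max (hL.norm_limit_le hj p.1.1) (hL.norm_limit_le hj p.1.2)
  have hf : f.SurjectiveOnWith (hL.graphLimit hj A).range.toAddSubgroup 2 := by
    rintro _ ⟨p, rfl⟩
    exact hL.exists_graphLimit_eq_norm_le hj A p
  refine isClosed_of_closure_subset fun h hh => ?_
  obtain ⟨p, hp, -⟩ := controlled_closure_of_complete two_pos one_pos hf h hh
  exact ⟨p, hp⟩

end IsLimitSpace

/-- For a net of closed (unbounded) operators `A n` on `E n`, the
set `Γ_∞ = { (j-lim x, j-lim (A n (x n))) : x ∈ dom(A_•) }` is a closed subspace of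
`E_∞ ⊕ E_∞` (the limit space being realized by `(G, L)`). -/
theorem limit_graph_closed (j : ∀ n m : N, E m →L[ℂ] E n)
    (hj : IsSoftInductiveSystem j)
    (A : ∀ n, E n →ₗ.[ℂ] E n)
    (hA : ∀ n, IsClosed ((A n).graph : Set (E n × E n)))
    {G : Type*} [NormedAddCommGroup G] [NormedSpace ℂ G] [CompleteSpace G]
    (L : (∀ n, E n) → G) (hL : IsLimitSpace j G L) :
    ∃ S : Submodule ℂ (G × G),
      (S : Set (G × G)) =
        {p : G × G | ∃ (x : ∀ n, E n) (_ : JConvergent j x)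
          (hd : ∀ n, x n ∈ (A n).domain),
          JConvergent j (fun n => A n ⟨x n, hd n⟩) ∧
          p = (L x, L (fun n => A n ⟨x n, hd n⟩))} ∧
      IsClosed (S : Set (G × G)) := by
  refine ⟨(hL.graphLimit hj A).range, ?_, hL.isClosed_range_graphLimit hj hA⟩
  ext p
  constructor
  · rintro ⟨⟨⟨x, y⟩, hp⟩, rfl⟩
    have hd : ∀ n, (x : lp E ∞) n ∈ (A n).domain := fun n =>
      LinearPMap.mem_domain_of_mem_graph (hp n)
    have hy : (fun n => A n ⟨(x : lp E ∞) n, hd n⟩) = ((y : lp E ∞) : ∀ n, E n) :=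
      funext fun n => ((LinearPMap.image_iff (hd n)).2 (hp n)).symm
    refine ⟨(x : lp E ∞), x.2, hd, ?_, ?_⟩
    · rw [hy]; exact y.2
    · rw [hy]; rfl
  · rintro ⟨x, hx, hd, hy, rfl⟩
    exact ⟨⟨(⟨⟨x, hx.1.memℓp⟩, hx⟩, ⟨⟨_, hy.1.memℓp⟩, hy⟩),
      fun n => (A n).mem_graph ⟨x n, hd n⟩⟩, rfl⟩
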